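/- arXiv:2604.09387 — 5 statements merged into one kernel-verified Lean document; each statement's English description precedes it below -/
import Mathlib

section
/- Let d ≥ 1 and λ > 0. Let G₁ and G₂ be real symmetric positive definite d×d matrices satisfying λ⁻¹‖v‖² ≤ vᵀGᵢv ≤ λ‖v‖² for all v ∈ ℝ^d (i = 1, 2). Then inf{‖R₁ − R₂‖_F : R₁ ∈ SO(G₁), R₂ ∈ SO(G₂)} ≤ (√λ/2)·‖G₁ − G₂‖_F. -/
open Matrix

/-- Frobenius norm of a real matrix. -/
noncomputable def frob {m n : Type*} [Fintype m] [Fintype n]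
    (A : Matrix m n ℝ) : ℝ := Real.sqrt (∑ i, ∑ j, (A i j) ^ 2)

/-- `SO(G)`: matrices representing orientation-preserving linear isometries from
`(ℝ^d, G)` to Euclidean `ℝ^d`. -/
def SOset (d : ℕ) (G : Matrix (Fin d) (Fin d) ℝ) : Set (Matrix (Fin d) (Fin d) ℝ) :=
  {R | Rᵀ * R = G ∧ 0 < R.det}

lemma trace_transpose_mul_self_eq_sum {m n : Type*} [Fintype m] [Fintype n]
    (A : Matrix m n ℝ) : (Aᵀ * A).trace = ∑ i, ∑ j, (A i j) ^ 2 := by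
  rw [Finset.sum_comm]
  simp [Matrix.trace, Matrix.mul_apply, sq]

/-- A positive semidefinite matrix whose square is bounded below by `c ^ 2` is itself bounded
below by `c`. -/
lemma posSemidef_sub_smul_one_of_sq {n : Type*} [Fintype n] [DecidableEq n]
    {S : Matrix n n ℝ} (hS : S.PosSemidef) {c : ℝ}
    (h : ∀ v : n → ℝ, c ^ 2 * (v ⬝ᵥ v) ≤ v ⬝ᵥ (S * S) *ᵥ v) :
    (S - c • (1 : Matrix n n ℝ)).PosSemidef := by
  have hH : (S - c • (1 : Matrix n n ℝ)).IsHermitian := by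
    refine hS.isHermitian.sub ?_
    simp [Matrix.IsHermitian]
  rw [hH.posSemidef_iff_eigenvalues_nonneg]
  intro j
  have hv := hH.mulVec_eigenvectorBasis j
  have hne : (hH.eigenvectorBasis j : n → ℝ) ≠ 0 := fun h0 =>
    hH.eigenvectorBasis.orthonormal.ne_zero j (by ext i; exact congrFun h0 i)
  generalize (hH.eigenvectorBasis j : n → ℝ) = v at hv hne
  generalize hH.eigenvalues j = μ at hv ⊢
  have hpos : 0 < v ⬝ᵥ v := by simpa using dotProduct_star_self_pos_iff.mpr hne
  have hSv : S *ᵥ v = (c + μ) • v := by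
    rw [sub_mulVec, smul_mulVec, one_mulVec, sub_eq_iff_eq_add] at hv
    rw [hv, add_smul, add_comm]
  have h1 : 0 ≤ (c + μ) * (v ⬝ᵥ v) := by
    simpa [hSv] using hS.dotProduct_mulVec_nonneg v
  have h2 : c ^ 2 * (v ⬝ᵥ v) ≤ (c + μ) ^ 2 * (v ⬝ᵥ v) := by
    simpa [← mulVec_mulVec, hSv, mulVec_smul, sq, mul_assoc] using h v
  have h3 := abs_le_of_sq_le_sq' (le_of_mul_le_mul_right h2 hpos)
    (nonneg_of_mul_nonneg_left h1 hpos)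
  simpa using h3.2

/-- If `S` and `T` are symmetric and bounded below by `c ≥ 0`, then
`2 * c * ‖S - T‖ ≤ ‖S ^ 2 - T ^ 2‖` in the Frobenius norm. -/
lemma frob_sub_le_frob_mul_self_sub {n : Type*} [Fintype n] [DecidableEq n]
    {S T : Matrix n n ℝ} {c : ℝ} (hc : 0 ≤ c) (hSs : Sᵀ = S) (hTs : Tᵀ = T)
    (hS : (S - c • (1 : Matrix n n ℝ)).PosSemidef)
    (hT : (T - c • (1 : Matrix n n ℝ)).PosSemidef) :
    2 * c * frob (S - T) ≤ frob (S * S - T * T) := by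
  set D := S - T with hD
  set E := S * S - T * T with hE
  have hDs : Dᵀ = D := by simp [hD, hSs, hTs]
  have hEs : Eᵀ = E := by simp [hE, hSs, hTs]
  have hED : E = S * D + D * T := by rw [hE, hD]; noncomm_ring
  have key {A : Matrix n n ℝ} (hA : (A - c • (1 : Matrix n n ℝ)).PosSemidef) :
      c * (D * D).trace ≤ (D * A * D).trace := by
    have := (hA.conjTranspose_mul_mul_same D).trace_nonneg
    rw [conjTranspose_eq_transpose_of_trivial, hDs] at this
    simpa [mul_sub, sub_mul] using this
  have hDE : (D * E).trace = (D * S * D).trace + (D * T * D).trace := by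
    rw [hED, mul_add, trace_add, ← mul_assoc, trace_mul_comm (D * T) D]
  have hnn : 0 ≤ ((E - (2 * c) • D)ᵀ * (E - (2 * c) • D)).trace := by
    rw [trace_transpose_mul_self_eq_sum]; positivity
  have hexp : ((E - (2 * c) • D)ᵀ * (E - (2 * c) • D)).trace
      = (E * E).trace - 4 * c * (D * E).trace + 4 * c ^ 2 * (D * D).trace := by
    simp only [transpose_sub, transpose_smul, hDs, hEs, sub_mul, mul_sub, trace_sub,
      Matrix.smul_mul, Matrix.mul_smul, trace_smul, smul_eq_mul, trace_mul_comm E D]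
    ring
  have hmain : (2 * c) ^ 2 * (D * D).trace ≤ (E * E).trace := by
    nlinarith [mul_le_mul_of_nonneg_left (key hS) hc, mul_le_mul_of_nonneg_left (key hT) hc]
  have hDD := trace_transpose_mul_self_eq_sum D
  have hEE := trace_transpose_mul_self_eq_sum E
  rw [hDs] at hDD
  rw [hEs] at hEE
  rw [frob, frob, ← hDD, ← hEE]
  refine Real.le_sqrt_of_sq_le ?_
  rwa [mul_pow, Real.sq_sqrt (by rw [hDD]; positivity)]

open scoped MatrixOrder in
/-- The positive square root of a positive definite matrix `G ≥ c ^ 2` is a symmetric element of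
`SOset d G` bounded below by `c`. -/
lemma exists_symm_mem_SOset {d : ℕ} {G : Matrix (Fin d) (Fin d) ℝ} (hG : G.PosDef) {c : ℝ}
    (h : ∀ v : Fin d → ℝ, c ^ 2 * (∑ i, (v i) ^ 2) ≤ v ⬝ᵥ G *ᵥ v) :
    ∃ S ∈ SOset d G, Sᵀ = S ∧ S * S = G ∧
      (S - c • (1 : Matrix (Fin d) (Fin d) ℝ)).PosSemidef := by
  have hS : (CFC.sqrt G).PosSemidef := (CFC.sqrt_nonneg G).posSemidef
  have hSS : CFC.sqrt G * CFC.sqrt G = G := CFC.sqrt_mul_sqrt_self G hG.posSemidef.nonneg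
  have hSt : (CFC.sqrt G)ᵀ = CFC.sqrt G := by
    simpa [conjTranspose_eq_transpose_of_trivial] using hS.isHermitian.eq
  have hdet : (CFC.sqrt G).det ≠ 0 := fun h0 => by
    have := hG.det_pos
    rw [← hSS, det_mul, h0] at this
    simp at this
  refine ⟨CFC.sqrt G, ⟨by rw [hSt, hSS], hS.det_nonneg.lt_of_ne' hdet⟩, hSt, hSS,
    posSemidef_sub_smul_one_of_sq hS fun v => ?_⟩
  rw [hSS]
  simpa [dotProduct, sq] using h v

theorem stmt_0 (d : ℕ) (hd : 1 ≤ d) (lam : ℝ) (hlam : 0 < lam)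
    (G₁ G₂ : Matrix (Fin d) (Fin d) ℝ)
    (hG₁s : G₁.IsSymm) (hG₂s : G₂.IsSymm)
    (hG₁p : G₁.PosDef) (hG₂p : G₂.PosDef)
    (hb₁ : ∀ v : Fin d → ℝ,
      lam⁻¹ * (∑ i, (v i) ^ 2) ≤ v ⬝ᵥ G₁.mulVec v ∧
      v ⬝ᵥ G₁.mulVec v ≤ lam * (∑ i, (v i) ^ 2))
    (hb₂ : ∀ v : Fin d → ℝ,
      lam⁻¹ * (∑ i, (v i) ^ 2) ≤ v ⬝ᵥ G₂.mulVec v ∧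
      v ⬝ᵥ G₂.mulVec v ≤ lam * (∑ i, (v i) ^ 2)) :
    sInf {r : ℝ | ∃ R₁ ∈ SOset d G₁, ∃ R₂ ∈ SOset d G₂, r = frob (R₁ - R₂)}
      ≤ (Real.sqrt lam / 2) * frob (G₁ - G₂) := by
  have hs : 0 < Real.sqrt lam := Real.sqrt_pos.mpr hlam
  have hc : (Real.sqrt lam)⁻¹ ^ 2 = lam⁻¹ := by rw [inv_pow, Real.sq_sqrt hlam.le]
  obtain ⟨S, hS, hSt, hSS, hSc⟩ := exists_symm_mem_SOset (c := (Real.sqrt lam)⁻¹) hG₁p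
    fun v => by rw [hc]; exact (hb₁ v).1
  obtain ⟨T, hT, hTt, hTT, hTc⟩ := exists_symm_mem_SOset (c := (Real.sqrt lam)⁻¹) hG₂p
    fun v => by rw [hc]; exact (hb₂ v).1
  have hbdd : BddBelow {r : ℝ | ∃ R₁ ∈ SOset d G₁, ∃ R₂ ∈ SOset d G₂, r = frob (R₁ - R₂)} := by
    refine ⟨0, ?_⟩
    rintro r ⟨R₁, -, R₂, -, rfl⟩
    exact Real.sqrt_nonneg _
  refine (csInf_le hbdd ⟨S, hS, T, hT, rfl⟩).trans ?_
  have h := frob_sub_le_frob_mul_self_sub (inv_nonneg.mpr hs.le) hSt hTt hSc hTc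
  rw [hSS, hTT] at h
  calc frob (S - T) = Real.sqrt lam / 2 * (2 * (Real.sqrt lam)⁻¹ * frob (S - T)) := by
        field_simp
    _ ≤ Real.sqrt lam / 2 * frob (G₁ - G₂) := by gcongr
end

section
/- Let d ≥ 1, c > 0, and let A, B be real symmetric positive semidefinite d×d matrices such that vᵀAv ≥ c‖v‖² and vᵀBv ≥ c‖v‖² for all v ∈ ℝ^d. Then ‖A − B‖_F ≤ (1/(2c))·‖A² − B²‖_F. -/
open Matrix

theorem frob_nonneg {m n : Type*} [Fintype m] [Fintype n] (A : Matrix m n ℝ) : 0 ≤ frob A :=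
  Real.sqrt_nonneg _

/-- Cauchy–Schwarz for the Frobenius inner product. -/
theorem sum_sum_mul_le_frob_mul_frob {m n : Type*} [Fintype m] [Fintype n]
    (A B : Matrix m n ℝ) : ∑ i, ∑ j, A i j * B i j ≤ frob A * frob B := by
  simp only [frob, ← Fintype.sum_prod_type']
  exact Real.sum_mul_le_sqrt_mul_sqrt _ _ _

theorem frob_sq {m n : Type*} [Fintype m] [Fintype n] (A : Matrix m n ℝ) :
    frob A ^ 2 = ∑ i, ∑ j, A i j ^ 2 :=
  Real.sq_sqrt (Finset.sum_nonneg fun _ _ => Finset.sum_nonneg fun _ _ => sq_nonneg _)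

theorem mul_frob_sq_le_sum_mul_left {m n : Type*} [Fintype m] [Fintype n]
    {A : Matrix m m ℝ} {c : ℝ} (hA : ∀ v : m → ℝ, c * ∑ i, v i ^ 2 ≤ v ⬝ᵥ A.mulVec v)
    (D : Matrix m n ℝ) : c * frob D ^ 2 ≤ ∑ i, ∑ j, D i j * (A * D) i j := by
  rw [frob_sq, Finset.sum_comm, Finset.mul_sum, Finset.sum_comm (s := (Finset.univ : Finset m))]
  exact Finset.sum_le_sum fun j _ => hA fun i => D i j

theorem mul_frob_sq_le_sum_mul_right {m n : Type*} [Fintype m] [Fintype n]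
    {B : Matrix n n ℝ} {c : ℝ} (hB : ∀ v : n → ℝ, c * ∑ i, v i ^ 2 ≤ v ⬝ᵥ B.mulVec v)
    (D : Matrix m n ℝ) : c * frob D ^ 2 ≤ ∑ i, ∑ j, D i j * (D * B) i j := by
  rw [frob_sq, Finset.mul_sum]
  refine Finset.sum_le_sum fun i _ => (hB (D i)).trans_eq ?_
  rw [dotProduct_mulVec, dotProduct_comm]
  rfl

theorem stmt_1 (d : ℕ) (hd : 1 ≤ d) (c : ℝ) (hc : 0 < c)
    (A B : Matrix (Fin d) (Fin d) ℝ)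
    (hAs : A.IsSymm) (hBs : B.IsSymm)
    (hApsd : A.PosSemidef) (hBpsd : B.PosSemidef)
    (hA : ∀ v : Fin d → ℝ, c * (∑ i, (v i) ^ 2) ≤ v ⬝ᵥ A.mulVec v)
    (hB : ∀ v : Fin d → ℝ, c * (∑ i, (v i) ^ 2) ≤ v ⬝ᵥ B.mulVec v) :
    frob (A - B) ≤ (1 / (2 * c)) * frob (A * A - B * B) := by
  have h_split : A * A - B * B = A * (A - B) + (A - B) * B := by noncomm_ring
  have h_inner : 2 * c * frob (A - B) ^ 2 ≤ frob (A - B) * frob (A * A - B * B) := by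
    refine le_trans ?_ (sum_sum_mul_le_frob_mul_frob _ _)
    rw [h_split]
    simp only [Matrix.add_apply, mul_add, Finset.sum_add_distrib]
    linarith [mul_frob_sq_le_sum_mul_left hA (A - B), mul_frob_sq_le_sum_mul_right hB (A - B)]
  rw [one_div_mul_eq_div, le_div_iff₀ (by positivity)]
  rcases (frob_nonneg (A - B)).eq_or_lt with h | h
  · rw [← h, zero_mul]
    exact frob_nonneg _
  · refine le_of_mul_le_mul_left ?_ h
    linarith
end

section
/- Let 1 ≤ d ≤ D, let L, R ∈ ℝ^{D×d} satisfy LᵀL = RᵀR = I_d (i.e., both have orthonormal columns), and let S ∈ ℝ^{d×d} be a diagonal matrix with nonnegative diagonal entries. Then ‖L − RS‖_F ≥ ‖R − RS‖_F. -/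
open Matrix

/-- For vectors `l`, `r` of equal Euclidean norm and a scalar `c ≥ 0`, the vector `r` is at
least as close to `c r` as `l` is. -/
theorem sum_sub_mul_sq_le {ι : Type*} [Fintype ι] {l r : ι → ℝ} {c : ℝ}
    (h : ∑ i, l i ^ 2 = ∑ i, r i ^ 2) (hc : 0 ≤ c) :
    ∑ i, (r i - r i * c) ^ 2 ≤ ∑ i, (l i - r i * c) ^ 2 := by
  have key : ∑ i, (l i - r i * c) ^ 2 - ∑ i, (r i - r i * c) ^ 2
      = c * ∑ i, (l i - r i) ^ 2 + (1 - c) * (∑ i, l i ^ 2 - ∑ i, r i ^ 2) := by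
    simp only [Finset.mul_sum, ← Finset.sum_sub_distrib, ← Finset.sum_add_distrib]
    exact Finset.sum_congr rfl fun i _ => by ring
  have : 0 ≤ c * ∑ i, (l i - r i) ^ 2 := by positivity
  rw [h, sub_self, mul_zero, add_zero] at key
  linarith

theorem sum_col_sq_eq_one {m n : Type*} [Fintype m] [DecidableEq n] {A : Matrix m n ℝ}
    (hA : Aᵀ * A = 1) (j : n) : ∑ i, A i j ^ 2 = 1 := by
  simpa [Matrix.mul_apply, sq] using congrFun (congrFun hA j) j

theorem stmt_8 (d D : ℕ) (hd : 1 ≤ d) (hdD : d ≤ D)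
    (L R : Matrix (Fin D) (Fin d) ℝ)
    (hL : Lᵀ * L = 1) (hR : Rᵀ * R = 1)
    (s : Fin d → ℝ) (hs : ∀ i, 0 ≤ s i) :
    frob (R - R * Matrix.diagonal s) ≤ frob (L - R * Matrix.diagonal s) := by
  refine Real.sqrt_le_sqrt ?_
  rw [Finset.sum_comm, Finset.sum_comm (f := fun i j => (L - R * Matrix.diagonal s) i j ^ 2)]
  refine Finset.sum_le_sum fun j _ => ?_
  simp only [Matrix.sub_apply, Matrix.mul_diagonal]
  exact sum_sub_mul_sq_le ((sum_col_sq_eq_one hL j).trans (sum_col_sq_eq_one hR j).symm) (hs j)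
end

section
/- Let 1 ≤ d ≤ D and let Π₀, Π ⊆ ℝ^D be d-dimensional linear subspaces. Set r := D − d, let (v₁, …, v_r) be an orthonormal basis of Π₀^⊥ and (w₁, …, w_r) an orthonormal basis of Π^⊥, and set δ := (Σⱼ ‖vⱼ − wⱼ‖²)^{1/2}. If δ < 1/(2d), then the restriction of the orthogonal projection P_{Π₀} : ℝ^D → Π₀ to Π is injective. -/
open Submodule

/-- Parseval's identity for a vector in the span of a finite orthonormal family. -/
theorem Orthonormal.sum_inner_sq_of_mem_span {ι E : Type*} [Fintype ι] [NormedAddCommGroup E]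
    [InnerProductSpace ℝ E] {v : ι → E} (hv : Orthonormal ℝ v) {z : E}
    (hz : z ∈ span ℝ (Set.range v)) : ∑ j, inner ℝ (v j) z ^ 2 = ‖z‖ ^ 2 := by
  obtain ⟨c, rfl⟩ := (mem_span_range_iff_exists_fun ℝ).1 hz
  rw [← real_inner_self_eq_norm_sq, hv.inner_sum]
  simp [hv.inner_right_fintype, sq]

/-- A vector in the span of a finite orthonormal family `v` which is orthogonal to a family `w`
at `ℓ²`-distance less than `1` from `v` vanishes. -/
theorem Orthonormal.eq_zero_of_mem_span_of_sum_norm_sub_sq_lt_one {ι E : Type*} [Fintype ι]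
    [NormedAddCommGroup E] [InnerProductSpace ℝ E] {v w : ι → E} (hv : Orthonormal ℝ v)
    (hvw : ∑ j, ‖v j - w j‖ ^ 2 < 1) {z : E} (hz : z ∈ span ℝ (Set.range v))
    (hwz : ∀ j, inner ℝ (w j) z = 0) : z = 0 := by
  have hle : ‖z‖ ^ 2 ≤ (∑ j, ‖v j - w j‖ ^ 2) * ‖z‖ ^ 2 := by
    rw [Finset.sum_mul]
    refine (hv.sum_inner_sq_of_mem_span hz).symm.trans_le (Finset.sum_le_sum fun j _ => ?_)
    have h : inner ℝ (v j) z = inner ℝ (v j - w j) z := by rw [inner_sub_left, hwz, sub_zero]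
    rw [h, ← mul_pow, sq_le_sq, abs_of_nonneg (by positivity : 0 ≤ ‖v j - w j‖ * ‖z‖)]
    exact abs_real_inner_le_norm _ _
  by_contra hne
  have : 0 < ‖z‖ ^ 2 := by positivity
  nlinarith

theorem stmt_9 (d D : ℕ) (hd : 1 ≤ d) (hdD : d ≤ D)
    (Pi0 Pi1 : Submodule ℝ (EuclideanSpace ℝ (Fin D)))
    (hPi0 : Module.finrank ℝ Pi0 = d) (hPi1 : Module.finrank ℝ Pi1 = d)
    (v w : Fin (D - d) → EuclideanSpace ℝ (Fin D))
    (hv : Orthonormal ℝ v) (hw : Orthonormal ℝ w)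
    (hvspan : Submodule.span ℝ (Set.range v) = Pi0ᗮ)
    (hwspan : Submodule.span ℝ (Set.range w) = Pi1ᗮ)
    (δ : ℝ) (hδ : δ = Real.sqrt (∑ j, ‖v j - w j‖ ^ 2))
    (hsmall : δ < 1 / (2 * d)) :
    Set.InjOn (fun x => orthogonalProjection Pi0 x) (Pi1 : Set (EuclideanSpace ℝ (Fin D))) := by
  have hδ_lt : δ < 1 := by
    have hd' : (1 : ℝ) ≤ d := by exact_mod_cast hd
    refine hsmall.trans_le ?_
    rw [div_le_one (by positivity)]
    linarith
  have hvw : ∑ j, ‖v j - w j‖ ^ 2 < 1 := by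
    rw [hδ, Real.sqrt_lt' one_pos, one_pow] at hδ_lt
    exact hδ_lt
  intro x hx y hy hxy
  rw [← sub_eq_zero]
  refine hv.eq_zero_of_mem_span_of_sum_norm_sub_sq_lt_one hvw ?_ fun j => ?_
  · rw [hvspan, ← orthogonalProjectionOnto_eq_zero_iff, map_sub, sub_eq_zero]
    exact hxy
  · have hwj : w j ∈ Pi1ᗮ := hwspan ▸ subset_span (Set.mem_range_self j)
    exact inner_left_of_mem_orthogonal (Pi1.sub_mem hx hy) hwj
end

section
/- Let d ≥ 1 and λ > 0, and let G₁, G₂ be real symmetric positive definite d×d matrices satisfying λ⁻¹‖v‖² ≤ vᵀGᵢv ≤ λ‖v‖² for all v ∈ ℝ^d (i = 1, 2). Then for every matrix A ∈ ℝ^{d×d}, dist_F(A, SO(G₁)) ≤ dist_F(A, SO(G₂)) + (√λ/2)·‖G₁ − G₂‖_F, where dist_F(A, S) := inf{‖A − R‖_F : R ∈ S}. -/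
open Matrix

/-- Frobenius distance from a matrix to a set of matrices. -/
noncomputable def distF {d : ℕ} (A : Matrix (Fin d) (Fin d) ℝ)
    (S : Set (Matrix (Fin d) (Fin d) ℝ)) : ℝ :=
  sInf {r : ℝ | ∃ R ∈ S, r = frob (A - R)}

theorem frob_sq_eq_trace {m n : Type*} [Fintype m] [Fintype n] (A : Matrix m n ℝ) :
    frob A ^ 2 = (Aᵀ * A).trace := by
  rw [frob, Real.sq_sqrt (by positivity), Finset.sum_comm]
  simp [Matrix.trace, Matrix.mul_apply, sq]

section Norm

attribute [local instance] Matrix.frobeniusNormedAddCommGroup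

theorem frob_add_le {m n : Type*} [Fintype m] [Fintype n] (A B : Matrix m n ℝ) :
    frob (A + B) ≤ frob A + frob B := by
  have h (C : Matrix m n ℝ) : frob C = ‖C‖ := by
    rw [frob, Matrix.frobenius_norm_def, Real.sqrt_eq_rpow]
    simp
  simpa only [h] using norm_add_le A B

end Norm

theorem trace_transpose_mul_le_frob_mul {m n : Type*} [Fintype m] [Fintype n]
    (A B : Matrix m n ℝ) : (Aᵀ * B).trace ≤ frob A * frob B := by
  have h := Real.sum_mul_le_sqrt_mul_sqrt (Finset.univ : Finset (m × n))
    (fun p => A p.1 p.2) (fun p => B p.1 p.2)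
  rw [Fintype.sum_prod_type, Fintype.sum_prod_type, Fintype.sum_prod_type] at h
  rw [frob, frob]
  refine le_trans (le_of_eq ?_) h
  rw [Finset.sum_comm]
  simp [Matrix.trace, Matrix.mul_apply]

theorem frob_mul_of_transpose_mul_self {m n : Type*} [Fintype m] [Fintype n] [DecidableEq m]
    {Q : Matrix m m ℝ} (hQ : Qᵀ * Q = 1) (A : Matrix m n ℝ) : frob (Q * A) = frob A := by
  have h : frob (Q * A) ^ 2 = frob A ^ 2 := by
    rw [frob_sq_eq_trace, frob_sq_eq_trace, Matrix.transpose_mul, Matrix.mul_assoc,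
      ← Matrix.mul_assoc Qᵀ, hQ, Matrix.one_mul]
  exact (sq_eq_sq₀ (frob_nonneg _) (frob_nonneg _)).mp h

/-- A positive definite matrix has a positive definite square root. -/
theorem Matrix.PosDef.exists_sqrt {n : Type*} [Fintype n] [DecidableEq n] {G : Matrix n n ℝ}
    (hG : G.PosDef) : ∃ S : Matrix n n ℝ, S.PosDef ∧ S * S = G := by
  open scoped MatrixOrder Matrix.Norms.L2Operator in
  have h0 : 0 ≤ G := hG.posSemidef.nonneg
  have hS : CFC.sqrt G * CFC.sqrt G = G := CFC.sqrt_mul_sqrt_self G h0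
  refine ⟨CFC.sqrt G, ?_, hS⟩
  refine (Matrix.nonneg_iff_posSemidef.mp (CFC.sqrt_nonneg G)).posDef_iff_isUnit.mpr ?_
  exact (CFC.isUnit_sqrt_iff G h0).mpr hG.isUnit

/-- A lower bound `μ ^ 2` for the square of a positive definite matrix gives the lower bound `μ`
for the matrix itself. -/
theorem Matrix.PosDef.posSemidef_sub_smul_one {n : Type*} [Fintype n] [DecidableEq n]
    {S : Matrix n n ℝ} (hS : S.PosDef) {μ : ℝ}
    (h : ∀ v : n → ℝ, μ ^ 2 * (v ⬝ᵥ v) ≤ v ⬝ᵥ (S * S) *ᵥ v) :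
    (S - μ • (1 : Matrix n n ℝ)).PosSemidef := by
  have hH : (S - μ • (1 : Matrix n n ℝ)).IsHermitian := by
    refine hS.isHermitian.sub ?_
    simp [Matrix.IsHermitian]
  rw [hH.posSemidef_iff_eigenvalues_nonneg]
  intro i
  set t := hH.eigenvalues i
  set v : n → ℝ := ⇑(hH.eigenvectorBasis i)
  have hSv : S *ᵥ v = (t + μ) • v := by
    have := hH.mulVec_eigenvectorBasis i
    rw [Matrix.sub_mulVec, Matrix.smul_mulVec, Matrix.one_mulVec, sub_eq_iff_eq_add] at this
    rw [add_smul]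
    exact this
  have hv0 : v ≠ 0 := by
    intro h0
    exact hH.eigenvectorBasis.toBasis.ne_zero i (by ext j; simpa using congrFun h0 j)
  have hpos : 0 < v ⬝ᵥ v := by simpa using Matrix.dotProduct_star_self_pos_iff.mpr hv0
  have h1 : 0 < t + μ := by
    have := hS.dotProduct_mulVec_pos hv0
    rw [hSv, star_trivial, dotProduct_smul, smul_eq_mul] at this
    exact pos_of_mul_pos_left this hpos.le
  have h2 := h v
  rw [← Matrix.mulVec_mulVec, hSv, Matrix.mulVec_smul, hSv, dotProduct_smul, dotProduct_smul,
    smul_eq_mul, smul_eq_mul, ← mul_assoc, ← sq] at h2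
  have h3 := abs_le_of_sq_le_sq' (le_of_mul_le_mul_right h2 hpos) h1.le
  show 0 ≤ t
  linarith [h3.2]

theorem mul_frob_sq_le_trace {n m : Type*} [Fintype n] [DecidableEq n] [Fintype m]
    {S : Matrix n n ℝ} {μ : ℝ} (hS : (S - μ • (1 : Matrix n n ℝ)).PosSemidef)
    (D : Matrix n m ℝ) : μ * frob D ^ 2 ≤ (Dᵀ * S * D).trace := by
  have h := (hS.conjTranspose_mul_mul_same D).trace_nonneg
  rw [Matrix.conjTranspose_eq_transpose_of_trivial, Matrix.mul_sub, Matrix.sub_mul,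
    Matrix.trace_sub, Matrix.mul_smul, Matrix.smul_mul, Matrix.mul_one, Matrix.trace_smul,
    ← frob_sq_eq_trace, smul_eq_mul] at h
  linarith

/-- The square root is Lipschitz with constant `1 / (2 * μ)` in the Frobenius norm on matrices
whose square root is bounded below by `μ`. -/
theorem two_mul_frob_sub_le {n : Type*} [Fintype n] [DecidableEq n] {S T : Matrix n n ℝ} {μ : ℝ}
    (hSs : S.IsSymm) (hTs : T.IsSymm) (hS : (S - μ • (1 : Matrix n n ℝ)).PosSemidef)
    (hT : (T - μ • (1 : Matrix n n ℝ)).PosSemidef) :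
    2 * μ * frob (S - T) ≤ frob (S * S - T * T) := by
  have hD : (S - T)ᵀ = S - T := hSs.sub hTs
  have h1 := mul_frob_sq_le_trace hS (S - T)
  have h2 := mul_frob_sq_le_trace hT (S - T)
  have h3 := trace_transpose_mul_le_frob_mul (S - T) (S * S - T * T)
  rw [hD] at h1 h2 h3
  have h4 : ((S - T) * (S * S - T * T)).trace
      = ((S - T) * S * (S - T)).trace + ((S - T) * T * (S - T)).trace := by
    rw [Matrix.trace_mul_comm ((S - T) * T), ← Matrix.trace_add]
    congr 1
    noncomm_ring
  rcases (frob_nonneg (S - T)).eq_or_lt with h0 | h0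
  · rw [← h0, mul_zero]
    exact frob_nonneg _
  · refine le_of_mul_le_mul_left ?_ h0
    nlinarith

theorem stmt_11 (d : ℕ) (hd : 1 ≤ d) (lam : ℝ) (hlam : 0 < lam)
    (G₁ G₂ : Matrix (Fin d) (Fin d) ℝ)
    (hG₁s : G₁.IsSymm) (hG₂s : G₂.IsSymm)
    (hG₁p : G₁.PosDef) (hG₂p : G₂.PosDef)
    (hb₁ : ∀ v : Fin d → ℝ,
      lam⁻¹ * (∑ i, (v i) ^ 2) ≤ v ⬝ᵥ G₁.mulVec v ∧
      v ⬝ᵥ G₁.mulVec v ≤ lam * (∑ i, (v i) ^ 2))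
    (hb₂ : ∀ v : Fin d → ℝ,
      lam⁻¹ * (∑ i, (v i) ^ 2) ≤ v ⬝ᵥ G₂.mulVec v ∧
      v ⬝ᵥ G₂.mulVec v ≤ lam * (∑ i, (v i) ^ 2))
    (A : Matrix (Fin d) (Fin d) ℝ) :
    distF A (SOset d G₁) ≤ distF A (SOset d G₂) +
      (Real.sqrt lam / 2) * frob (G₁ - G₂) := by
  obtain ⟨S₁, hS₁, hSG₁⟩ := hG₁p.exists_sqrt
  obtain ⟨S₂, hS₂, hSG₂⟩ := hG₂p.exists_sqrt
  have hsymm₁ : S₁ᵀ = S₁ := by simpa using hS₁.isHermitian.eq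
  have hsymm₂ : S₂ᵀ = S₂ := by simpa using hS₂.isHermitian.eq
  have hsqrt : 0 < √lam := Real.sqrt_pos.mpr hlam
  have hsq : (√lam)⁻¹ ^ 2 = lam⁻¹ := by rw [inv_pow, Real.sq_sqrt hlam.le]
  have hlow₁ := hS₁.posSemidef_sub_smul_one (μ := (√lam)⁻¹) fun v => by
    rw [hsq, hSG₁]
    simpa [dotProduct, sq] using (hb₁ v).1
  have hlow₂ := hS₂.posSemidef_sub_smul_one (μ := (√lam)⁻¹) fun v => by
    rw [hsq, hSG₂]
    simpa [dotProduct, sq] using (hb₂ v).1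
  have hdist : frob (S₂ - S₁) ≤ √lam / 2 * frob (G₁ - G₂) := by
    have h := two_mul_frob_sub_le hsymm₁ hsymm₂ hlow₁ hlow₂
    rw [hSG₁, hSG₂] at h
    have hneg : frob (S₂ - S₁) = frob (S₁ - S₂) := by
      simp only [frob, Matrix.sub_apply, sub_sq_comm]
    rw [hneg]
    calc frob (S₁ - S₂) = √lam / 2 * (2 * (√lam)⁻¹ * frob (S₁ - S₂)) := by field_simp
      _ ≤ _ := by gcongr
  rw [← sub_le_iff_le_add]
  refine le_csInf ⟨_, S₂, ⟨by rw [hsymm₂, hSG₂], hS₂.det_pos⟩, rfl⟩ ?_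
  rintro _ ⟨R, ⟨hRG, hRdet⟩, rfl⟩
  have hunit : IsUnit S₂.det := hS₂.det_pos.ne'.isUnit
  have hQ : (R * S₂⁻¹)ᵀ * (R * S₂⁻¹) = 1 := by
    rw [Matrix.transpose_mul, Matrix.transpose_nonsing_inv, hsymm₂, Matrix.mul_assoc,
      ← Matrix.mul_assoc Rᵀ, hRG, ← hSG₂, Matrix.mul_assoc, Matrix.mul_nonsing_inv _ hunit,
      Matrix.mul_one, Matrix.nonsing_inv_mul _ hunit]
  have hmem : R * S₂⁻¹ * S₁ ∈ SOset d G₁ := by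
    refine ⟨?_, ?_⟩
    · rw [Matrix.transpose_mul, hsymm₁, Matrix.mul_assoc, ← Matrix.mul_assoc (R * S₂⁻¹)ᵀ, hQ,
        Matrix.one_mul, hSG₁]
    · rw [Matrix.det_mul, Matrix.det_mul]
      exact mul_pos (mul_pos hRdet hS₂.inv.det_pos) hS₁.det_pos
  have hle : distF A (SOset d G₁) ≤ frob (A - R * S₂⁻¹ * S₁) :=
    csInf_le ⟨0, by rintro _ ⟨_, _, rfl⟩; exact frob_nonneg _⟩ ⟨_, hmem, rfl⟩
  have hsplit : A - R * S₂⁻¹ * S₁ = (A - R) + R * S₂⁻¹ * (S₂ - S₁) := by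
    rw [Matrix.mul_sub, Matrix.nonsing_inv_mul_cancel_right _ _ hunit]
    abel
  have htri := frob_add_le (A - R) (R * S₂⁻¹ * (S₂ - S₁))
  rw [← hsplit, frob_mul_of_transpose_mul_self hQ] at htri
  linarith
end
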